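/- Let d be a function on (x_L, x_R) with 0 ≤ κ_min ≤ d(x) ≤ κ_max < ∞ for all x, and suppose d is either concave or convex on (x_L,x_R); put κ = κ_max if d is concave and κ = κ_min if d is convex. Set D = diag(d(x_1),…,d(x_M)) and D̃ = D − κ·I_M. Then for every u ∈ ℝ^M: |uᵀ(−D̃G_α − G_αᵀD̃)u| ≤ (√2·(κ_max − κ_min)/ς_α) · uᵀ G u. -/

import Mathlib

open Matrix

/-- The Grünwald–Letnikov coefficients `g_k^{(α)}`. -/
noncomputable def gcoef (α : ℝ) : ℕ → ℝ
  | 0 => 1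
  | (k+1) => (1 - (α + 1) / (k + 1 : ℕ)) * gcoef α k

/-- The WSGD coefficients `w_k^{(α)}`. -/
noncomputable def wcoef (α : ℝ) : ℕ → ℝ
  | 0 => α / 2 * gcoef α 0
  | (k+1) => α / 2 * gcoef α (k+1) + (2 - α) / 2 * gcoef α k

/-- The `M × M` lower-Hessenberg Toeplitz matrix `G_α`. -/
noncomputable def Gmat (α : ℝ) (M : ℕ) : Matrix (Fin M) (Fin M) ℝ :=
  Matrix.of fun i j => if (j : ℕ) ≤ (i : ℕ) + 1 then wcoef α ((i : ℕ) + 1 - (j : ℕ)) else 0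

theorem gcoef_succ (α : ℝ) (k : ℕ) :
    gcoef α (k + 1) = (1 - (α + 1) / (k + 1)) * gcoef α k := by
  simp [gcoef]

theorem gcoef_nonneg {α : ℝ} (hα : α ∈ Set.Ioo (1 : ℝ) 2) (k : ℕ) : 0 ≤ gcoef α (k + 2) := by
  obtain ⟨h1, h2⟩ := hα
  induction k with
  | zero =>
    simp only [gcoef]
    norm_num
    nlinarith
  | succ k ih =>
    rw [show k + 1 + 2 = k + 2 + 1 by ring, gcoef_succ]
    refine mul_nonneg ?_ ih
    have hk : (0 : ℝ) ≤ k := k.cast_nonneg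
    rw [sub_nonneg, div_le_one (by positivity)]
    push_cast
    linarith

theorem gcoef_sum_nonpos {α : ℝ} (hα : α ∈ Set.Ioo (1 : ℝ) 2) (n : ℕ) :
    ∑ k ∈ Finset.range (n + 2), gcoef α k ≤ 0 := by
  have hα0 : α ≠ 0 := by linarith [hα.1]
  have key : ∀ m : ℕ, ∑ k ∈ Finset.range (m + 1), gcoef α k = -((m + 1) / α) * gcoef α (m + 1) := by
    intro m
    induction m with
    | zero => simp [gcoef]; field_simp
    | succ m ih =>
      rw [Finset.sum_range_succ, ih, gcoef_succ α (m + 1)]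
      have : (m : ℝ) + 1 + 1 ≠ 0 := by positivity
      push_cast
      field_simp
      ring
  rw [key (n + 1)]
  have := gcoef_nonneg hα n
  have hα1 : 0 < α := by linarith [hα.1]
  have : 0 ≤ ((n : ℝ) + 1 + 1) / α * gcoef α (n + 2) := by positivity
  push_cast
  linarith

theorem summable_abs_gcoef {α : ℝ} (hα : α ∈ Set.Ioo (1 : ℝ) 2) :
    Summable fun k => |gcoef α k| := by
  rw [← summable_nat_add_iff 2]
  refine summable_of_sum_range_le (c := α - 1) (fun _ => abs_nonneg _) fun n => ?_
  have h := gcoef_sum_nonpos hα n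
  rw [add_comm, Finset.sum_range_add] at h
  simp only [Finset.sum_range_succ, Finset.sum_range_zero, gcoef] at h
  rw [Finset.sum_congr rfl fun k _ => abs_of_nonneg (gcoef_nonneg hα k)]
  simp only [add_comm _ 2]
  norm_num at h
  linarith

theorem ring_choose_eq_gcoef (α : ℝ) (k : ℕ) :
    Ring.choose (α : ℂ) k * (-1) ^ k = (gcoef α k : ℂ) := by
  induction k with
  | zero => simp [gcoef]
  | succ k ih =>
    have hk : ((k : ℂ) + 1) ≠ 0 := by exact_mod_cast k.succ_ne_zero
    have hs : ((k : ℂ) + 1) * Ring.choose (α : ℂ) (k + 1) = (α - k) * Ring.choose (α : ℂ) k := by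
      simpa [mul_comm] using Ring.choose_smul_choose (α : ℂ) k.le_succ
    rw [gcoef_succ]
    push_cast
    rw [← ih, pow_succ]
    field_simp
    linear_combination -hs

theorem hasSum_gcoef_mul_pow {α : ℝ} (hα : α ∈ Set.Ioo (1 : ℝ) 2) {z : ℂ} (hz : ‖z‖ ≤ 1) :
    HasSum (fun k => (gcoef α k : ℂ) * z ^ k) ((1 - z) ^ (α : ℂ)) := by
  have hbd : ∀ k, ∀ x ∈ Metric.closedBall (0 : ℂ) 1, ‖(gcoef α k : ℂ) * x ^ k‖ ≤ |gcoef α k| := by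
    intro k x hx
    rw [mem_closedBall_zero_iff] at hx
    rw [norm_mul, norm_pow, Complex.norm_real, Real.norm_eq_abs]
    exact mul_le_of_le_one_right (abs_nonneg _) (pow_le_one₀ (norm_nonneg _) hx)
  have hS : ∀ x ∈ Metric.closedBall (0 : ℂ) 1, Summable fun k => (gcoef α k : ℂ) * x ^ k :=
    fun x hx => (summable_abs_gcoef hα).of_norm_bounded fun k => hbd k x hx
  have hcont : ContinuousOn (fun x : ℂ => ∑' k, (gcoef α k : ℂ) * x ^ k)
      (Metric.closedBall (0 : ℂ) 1) :=
    continuousOn_tsum (fun k => by fun_prop) (summable_abs_gcoef hα) hbd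
  have hcont' : ContinuousOn (fun x : ℂ => (1 - x) ^ (α : ℂ)) (Metric.closedBall (0 : ℂ) 1) := by
    intro x hx
    rw [mem_closedBall_zero_iff] at hx
    refine ContinuousAt.continuousWithinAt ?_
    refine ContinuousAt.comp (f := fun x : ℂ => 1 - x) (g := fun y : ℂ => y ^ (α : ℂ))
      (Complex.continuousAt_cpow_const_of_re_pos (Or.inl ?_) ?_) (by fun_prop)
    · simpa using (Complex.re_le_norm x).trans hx
    · simpa using lt_trans one_pos hα.1
  have hEq : Set.EqOn (fun x : ℂ => ∑' k, (gcoef α k : ℂ) * x ^ k)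
      (fun x : ℂ => (1 - x) ^ (α : ℂ)) (Metric.ball (0 : ℂ) 1) := by
    intro x hx
    rw [mem_ball_zero_iff] at hx
    have h := (Complex.one_add_cpow_hasFPowerSeriesOnBall_zero (a := (α : ℂ))).hasSum
      (y := -x) (by
        rw [Metric.mem_eball, edist_zero_right, enorm_neg, ← ofReal_norm]
        exact_mod_cast (ENNReal.ofReal_lt_one.mpr hx))
    refine HasSum.tsum_eq ?_
    have hk : ∀ k, (gcoef α k : ℂ) * x ^ k = binomialSeries ℂ (α : ℂ) k fun _ => -x := by
      intro k
      rw [← ring_choose_eq_gcoef, binomialSeries_apply]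
      simp only [List.ofFn_const, List.prod_replicate, smul_eq_mul]
      rw [neg_pow x]
      ring
    rw [zero_add, ← sub_eq_add_neg] at h
    simpa only [hk] using h
  have hz' : z ∈ Metric.closedBall (0 : ℂ) 1 := by simpa using hz
  have := hEq.of_subset_closure hcont hcont' Metric.ball_subset_closedBall
    (by rw [closure_ball _ one_ne_zero]) hz'
  rw [← show (∑' k, (gcoef α k : ℂ) * z ^ k) = (1 - z) ^ (α : ℂ) from this]
  exact (hS z hz').hasSum

theorem summable_abs_wcoef {α : ℝ} (hα : α ∈ Set.Ioo (1 : ℝ) 2) :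
    Summable fun k => |wcoef α k| := by
  rw [← summable_nat_add_iff 1]
  have h := summable_abs_gcoef hα
  refine Summable.of_nonneg_of_le (fun _ => abs_nonneg _) (fun k => ?_)
    ((((summable_nat_add_iff 1).mpr h).mul_left |α / 2|).add (h.mul_left |(2 - α) / 2|))
  simp only [wcoef, ← abs_mul]
  exact abs_add_le _ _

theorem hasSum_wcoef_mul_pow {α : ℝ} (hα : α ∈ Set.Ioo (1 : ℝ) 2) {z : ℂ} (hz : ‖z‖ ≤ 1) :
    HasSum (fun k => (wcoef α k : ℂ) * z ^ k)
      ((α / 2 + (2 - α) / 2 * z) * (1 - z) ^ (α : ℂ)) := by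
  have h := hasSum_gcoef_mul_pow hα hz
  rw [← hasSum_nat_add_iff' 1] at h ⊢
  have h' := (h.mul_left (α / 2 : ℂ)).add
    ((hasSum_gcoef_mul_pow hα hz).mul_left ((2 - α) / 2 * z))
  have hk : ∀ k, (wcoef α (k + 1) : ℂ) * z ^ (k + 1) =
      α / 2 * (gcoef α (k + 1) * z ^ (k + 1)) + (2 - α) / 2 * z * (gcoef α k * z ^ k) := by
    intro k
    simp only [wcoef]
    push_cast
    ring
  simp only [hk]
  rw [show (α / 2 + (2 - α) / 2 * z) * (1 - z) ^ (α : ℂ) -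
      ∑ i ∈ Finset.range 1, (wcoef α i : ℂ) * z ^ i = α / 2 * ((1 - z) ^ (α : ℂ) -
      ∑ i ∈ Finset.range 1, (gcoef α i : ℂ) * z ^ i) + (2 - α) / 2 * z * (1 - z) ^ (α : ℂ) by
    simp [wcoef, gcoef]
    ring]
  exact h'

/-- The generating symbol of the Toeplitz matrix `-G_α`. -/
noncomputable def wsymbol (α θ : ℝ) : ℂ :=
  -∑' k : ℕ, (wcoef α k : ℂ) * Complex.exp ((k - 1) * θ * Complex.I)

theorem norm_wcoef_mul_exp (α θ : ℝ) (k : ℕ) :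
    ‖(wcoef α k : ℂ) * Complex.exp ((k - 1) * θ * Complex.I)‖ = |wcoef α k| := by
  have : ((k : ℂ) - 1) * θ * Complex.I = (((k - 1) * θ : ℝ) : ℂ) * Complex.I := by push_cast; ring
  rw [norm_mul, this, Complex.norm_exp_ofReal_mul_I, mul_one, Complex.norm_real, Real.norm_eq_abs]

theorem continuous_wsymbol {α : ℝ} (hα : α ∈ Set.Ioo (1 : ℝ) 2) : Continuous (wsymbol α) :=
  (continuous_tsum (fun k => by fun_prop) (summable_abs_wcoef hα)
    fun k θ => (norm_wcoef_mul_exp α θ k).le).neg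

theorem wsymbol_neg (α θ : ℝ) : wsymbol α (-θ) = (starRingEnd ℂ) (wsymbol α θ) := by
  simp only [wsymbol, map_neg, Complex.conj_tsum, map_mul, Complex.conj_ofReal, ← Complex.exp_conj]
  simp

theorem wsymbol_eq {α : ℝ} (hα : α ∈ Set.Ioo (1 : ℝ) 2) (θ : ℝ) :
    wsymbol α θ = -(Complex.exp (-(θ * Complex.I)) *
      ((α / 2 + (2 - α) / 2 * Complex.exp (θ * Complex.I)) *
        (1 - Complex.exp (θ * Complex.I)) ^ (α : ℂ))) := by
  have h := (hasSum_wcoef_mul_pow hα (Complex.norm_exp_ofReal_mul_I θ).le).mul_left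
    (Complex.exp (-(θ * Complex.I)))
  rw [wsymbol, ← h.tsum_eq]
  congr 2
  ext k
  rw [← Complex.exp_nat_mul, mul_left_comm, ← Complex.exp_add]
  congr 2
  ring

theorem one_sub_exp_cpow (α : ℝ) {θ : ℝ} (h0 : 0 < θ) (hπ : θ ≤ Real.pi) :
    (1 - Complex.exp (θ * Complex.I)) ^ (α : ℂ) =
      (((2 * Real.sin (θ / 2)) ^ α : ℝ) : ℂ) *
        Complex.exp (((α * (θ - Real.pi) / 2 : ℝ) : ℂ) * Complex.I) := by
  have hs : 0 < 2 * Real.sin (θ / 2) :=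
    mul_pos two_pos (Real.sin_pos_of_pos_of_lt_pi (by linarith) (by linarith))
  have hform : 1 - Complex.exp (θ * Complex.I) = ((2 * Real.sin (θ / 2) : ℝ) : ℂ) *
      Complex.exp ((((θ - Real.pi) / 2 : ℝ) : ℂ) * Complex.I) := by
    have e1 : Complex.exp (θ * Complex.I) =
        Complex.exp (((θ / 2 : ℝ) : ℂ) * Complex.I) ^ 2 := by
      rw [← Complex.exp_nat_mul]; congr 1; push_cast; ring
    have e2 : ((((θ - Real.pi) / 2 : ℝ) : ℂ) * Complex.I) =
        ((θ / 2 : ℝ) : ℂ) * Complex.I - Real.pi / 2 * Complex.I := by push_cast; ring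
    rw [e1, e2, Complex.exp_sub, Complex.exp_pi_div_two_mul_I, Complex.exp_mul_I]
    push_cast
    have := Complex.sin_sq_add_cos_sq ((θ : ℂ) / 2)
    have hI := Complex.I_sq
    field_simp
    linear_combination (-Complex.I) * this + 
      (-Complex.I * Complex.sin (θ / 2) ^ 2 - 2 * Complex.cos (θ / 2) * Complex.sin (θ / 2)) * hI
  have hlog : Complex.log (1 - Complex.exp (θ * Complex.I)) =
      (Real.log (2 * Real.sin (θ / 2)) : ℂ) + (((θ - Real.pi) / 2 : ℝ) : ℂ) * Complex.I := by
    rw [hform, Complex.log_ofReal_mul hs (Complex.exp_ne_zero _), Complex.log_exp]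
    · simp; linarith [Real.pi_pos]
    · simp; linarith [Real.pi_pos]
  have hne : 1 - Complex.exp (θ * Complex.I) ≠ 0 := by
    rw [hform]
    exact mul_ne_zero (by exact_mod_cast hs.ne') (Complex.exp_ne_zero _)
  rw [Complex.cpow_def_of_ne_zero hne, hlog, Real.rpow_def_of_pos hs, Complex.ofReal_exp,
    ← Complex.exp_add]
  congr 1
  push_cast
  ring

theorem mul_sin_le_mul_sin {β θ : ℝ} (hβ : 0 < β) (hβ' : β < 1 / 2) (h0 : 0 ≤ θ)
    (hπ : θ ≤ Real.pi) :
    β * Real.sin ((1 - β) * θ) ≤ (1 - β) * Real.sin (β * θ) := by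
  have h1 : 0 < 1 - β := by linarith
  have hmem : (1 - β) * θ ∈ Set.Icc 0 Real.pi := ⟨by positivity, by nlinarith⟩
  have h := strictConcaveOn_sin_Icc.concaveOn.2 hmem
    (Set.left_mem_Icc.mpr Real.pi_pos.le) (by positivity : 0 ≤ β / (1 - β))
    (sub_nonneg.mpr ((div_le_one h1).mpr (by linarith)))
    (add_sub_cancel (β / (1 - β)) 1)
  have e : β / (1 - β) * ((1 - β) * θ) = β * θ := by field_simp
  simp only [smul_eq_mul, mul_zero, add_zero, Real.sin_zero, e] at h
  calc β * Real.sin ((1 - β) * θ)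
      = (1 - β) * (β / (1 - β) * Real.sin ((1 - β) * θ)) := by field_simp
    _ ≤ _ := mul_le_mul_of_nonneg_left h h1.le

theorem mul_norm_le_re_of_sector {z : ℂ} {c s : ℝ} (hc : 0 < c) (hs : 0 < s)
    (hcs : s ^ 2 + c ^ 2 = 1) (h0 : 0 ≤ z.im) (h : z.im * c ≤ z.re * s) : c * ‖z‖ ≤ z.re := by
  have hre : 0 ≤ z.re := nonneg_of_mul_nonneg_left ((mul_nonneg h0 hc.le).trans h) hs
  refine abs_le_of_sq_le_sq' ?_ hre |>.2
  rw [mul_pow, ← Complex.normSq_eq_norm_sq, Complex.normSq_apply]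
  have := mul_self_le_mul_self (mul_nonneg h0 hc.le) h
  nlinarith

theorem cos_mul_norm_wsymbol_le {α : ℝ} (hα : α ∈ Set.Ioo (1 : ℝ) 2) (θ : ℝ)
    (hθ : θ ∈ Set.Icc (-Real.pi) Real.pi) :
    |Real.cos (α * Real.pi / 2)| * ‖wsymbol α θ‖ ≤ (wsymbol α θ).re := by
  wlog hpos : 0 ≤ θ generalizing θ
  · have := this (-θ) ⟨by linarith [hθ.2], by linarith [hθ.1]⟩ (by linarith)
    simpa [wsymbol_neg] using this
  rcases hpos.eq_or_lt with rfl | hpos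
  · rw [wsymbol_eq hα]
    have : (α : ℂ) ≠ 0 := by exact_mod_cast (lt_trans one_pos hα.1).ne'
    simp [Complex.zero_cpow this]
  obtain ⟨h1, h2⟩ := hα
  have hπ := Real.pi_pos
  obtain ⟨β, rfl⟩ : ∃ β, α = 2 - 2 * β := ⟨1 - α / 2, by ring⟩
  have hβ : 0 < β := by linarith
  have hβ' : β < 1 / 2 := by linarith
  have hcos : 0 < Real.cos (β * Real.pi) :=
    Real.cos_pos_of_mem_Ioo ⟨by nlinarith, by nlinarith⟩
  have hsin : 0 < Real.sin (β * Real.pi) :=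
    Real.sin_pos_of_pos_of_lt_pi (by positivity) (by nlinarith)
  have hς : |Real.cos ((2 - 2 * β) * Real.pi / 2)| = Real.cos (β * Real.pi) := by
    rw [show (2 - 2 * β) * Real.pi / 2 = Real.pi - β * Real.pi by ring, Real.cos_pi_sub, abs_neg,
      abs_of_pos hcos]
  set r : ℝ := (2 * Real.sin (θ / 2)) ^ (2 - 2 * β) with hr
  have hr0 : 0 ≤ r := Real.rpow_nonneg (mul_nonneg two_pos.le
    (Real.sin_nonneg_of_nonneg_of_le_pi (by linarith) (by linarith [hθ.2]))) _
  set A : ℝ := β * (Real.pi - θ) with hA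
  set q : ℂ := (((1 - β) * Real.cos A + β * Real.cos (A + θ) : ℝ) : ℂ) +
    (((1 - β) * Real.sin A + β * Real.sin (A + θ) : ℝ) : ℂ) * Complex.I with hq
  have hsym : wsymbol (2 - 2 * β) θ = r * q := by
    have e1 : Complex.exp (A * Complex.I) = -(Complex.exp (-(θ * Complex.I)) *
        Complex.exp ((((2 - 2 * β) * (θ - Real.pi) / 2 : ℝ) : ℂ) * Complex.I)) := by
      rw [← Complex.exp_add, ← neg_one_mul, ← Complex.exp_pi_mul_I, ← Complex.exp_add]
      congr 1
      rw [hA]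
      push_cast
      ring
    have e2 : q = (1 - β) * Complex.exp (A * Complex.I) +
        β * (Complex.exp (A * Complex.I) * Complex.exp (θ * Complex.I)) := by
      rw [← Complex.exp_add, ← add_mul, ← Complex.ofReal_add, Complex.exp_mul_I, Complex.exp_mul_I,
        hq]
      push_cast
      ring
    rw [wsymbol_eq ⟨h1, h2⟩, one_sub_exp_cpow _ hpos hθ.2, ← hr, e2, e1]
    push_cast
    ring
  have hqre : q.re = (1 - β) * Real.cos A + β * Real.cos (A + θ) := by
    simp only [hq, Complex.add_re, Complex.ofReal_re, Complex.re_ofReal_mul, Complex.I_re,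
      mul_zero, add_zero]
  have hqim : q.im = (1 - β) * Real.sin A + β * Real.sin (A + θ) := by
    simp only [hq, Complex.add_im, Complex.ofReal_im, Complex.im_ofReal_mul, Complex.I_im,
      mul_one, zero_add]
  rw [hς, hsym, norm_mul, Complex.re_ofReal_mul, Complex.norm_real, Real.norm_of_nonneg hr0,
    mul_left_comm]
  refine mul_le_mul_of_nonneg_left ?_ hr0
  have hA0 : 0 ≤ A := mul_nonneg hβ.le (by linarith [hθ.2])
  have hA1 : A + θ ≤ Real.pi := by nlinarith [hθ.2]
  refine mul_norm_le_re_of_sector hcos hsin (Real.sin_sq_add_cos_sq _) ?_ ?_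
  · rw [hqim]
    have := Real.sin_nonneg_of_nonneg_of_le_pi hA0 (by linarith)
    have := Real.sin_nonneg_of_nonneg_of_le_pi (by linarith : 0 ≤ A + θ) hA1
    have : 0 ≤ 1 - β := by linarith
    positivity
  · have key := mul_sin_le_mul_sin hβ hβ' hpos.le hθ.2
    have s1 : Real.sin (β * θ) = Real.sin (β * Real.pi) * Real.cos A -
        Real.cos (β * Real.pi) * Real.sin A := by
      rw [← Real.sin_sub]; congr 1; rw [hA]; ring
    have s2 : Real.sin ((1 - β) * θ) = Real.sin (A + θ) * Real.cos (β * Real.pi) -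
        Real.cos (A + θ) * Real.sin (β * Real.pi) := by
      rw [← Real.sin_sub]; congr 1; rw [hA]; ring
    rw [s1, s2] at key
    rw [hqre, hqim]
    linarith

/-- The Toeplitz symbol coefficients of `G_α`, indexed by the diagonal. -/
noncomputable def wint (α : ℝ) (n : ℤ) : ℝ := if 0 ≤ n + 1 then wcoef α (n + 1).toNat else 0

theorem Gmat_apply (α : ℝ) {M : ℕ} (i j : Fin M) : Gmat α M i j = wint α ((i : ℤ) - (j : ℤ)) := by
  rw [Gmat, wint, Matrix.of_apply]
  refine if_congr (by omega) (congrArg _ (by omega)) rfl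

theorem integral_exp_int_mul (m : ℤ) :
    ∫ θ in (-Real.pi)..Real.pi, Complex.exp (m * θ * Complex.I) =
      if m = 0 then (2 * Real.pi : ℂ) else 0 := by
  split_ifs with hm
  · simp [hm]
    ring
  · have hc : (m : ℂ) * Complex.I ≠ 0 := mul_ne_zero (by exact_mod_cast hm) Complex.I_ne_zero
    simp only [mul_right_comm (m : ℂ)]
    rw [integral_exp_mul_complex hc, div_eq_zero_iff, sub_eq_zero]
    refine Or.inl (Complex.exp_eq_exp_iff_exists_int.mpr ⟨m, ?_⟩)
    push_cast
    ring

theorem integral_wsymbol_mul_exp {α : ℝ} (hα : α ∈ Set.Ioo (1 : ℝ) 2) (n : ℤ) :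
    ∫ θ in (-Real.pi)..Real.pi, wsymbol α θ * Complex.exp (-(n * θ * Complex.I)) =
      -(2 * Real.pi * wint α n) := by
  have hterm : ∀ (k : ℕ) (θ : ℝ), -((wcoef α k : ℂ) * Complex.exp ((k - 1) * θ * Complex.I)) *
      Complex.exp (-(n * θ * Complex.I)) =
      -(wcoef α k : ℂ) * Complex.exp (((k - 1 - n : ℤ) : ℂ) * θ * Complex.I) := by
    intro k θ
    rw [neg_mul, mul_assoc, ← Complex.exp_add, neg_mul]
    congr 3
    push_cast
    ring
  have hsum := intervalIntegral.hasSum_integral_of_dominated_convergence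
    (μ := MeasureTheory.volume) (a := -Real.pi) (b := Real.pi)
    (F := fun (k : ℕ) (θ : ℝ) => -((wcoef α k : ℂ) * Complex.exp ((k - 1) * θ * Complex.I)) *
      Complex.exp (-(n * θ * Complex.I)))
    (f := fun θ => wsymbol α θ * Complex.exp (-(n * θ * Complex.I)))
    (fun k _ => |wcoef α k|)
    (fun k => (Continuous.aestronglyMeasurable (by fun_prop)))
    (fun k => Filter.Eventually.of_forall fun θ _ => by
      rw [norm_mul, norm_neg, norm_wcoef_mul_exp, ← neg_mul, ← neg_mul, ← Complex.ofReal_intCast,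
        ← Complex.ofReal_neg, ← Complex.ofReal_mul, Complex.norm_exp_ofReal_mul_I, mul_one])
    (Filter.Eventually.of_forall fun θ _ => summable_abs_wcoef hα)
    (by simp)
    (Filter.Eventually.of_forall fun θ _ => by
      refine HasSum.mul_right _ (HasSum.neg (Summable.hasSum ?_))
      refine (summable_abs_wcoef hα).of_norm_bounded fun k => (norm_wcoef_mul_exp α θ k).le)
  simp only [hterm, intervalIntegral.integral_const_mul, integral_exp_int_mul] at hsum
  refine hsum.unique ?_
  by_cases hn : 0 ≤ n + 1
  · have h := hasSum_single (f := fun k : ℕ => -(wcoef α k : ℂ) *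
      if (k : ℤ) - 1 - n = 0 then (2 * Real.pi : ℂ) else 0) (n + 1).toNat fun k hk => by
        rw [if_neg (by omega), mul_zero]
    rw [if_pos (by omega)] at h
    rw [wint, if_pos hn]
    convert! h using 1
    ring
  · rw [wint, if_neg hn]
    convert! hasSum_zero using 2 with k
    · rw [if_neg (by omega), mul_zero]
    · simp

/-- The trigonometric polynomial with coefficient vector `u`. -/
noncomputable def trigPoly {M : ℕ} (u : Fin M → ℝ) (θ : ℝ) : ℂ :=
  ∑ j, (u j : ℂ) * Complex.exp ((j : ℕ) * θ * Complex.I)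

theorem continuous_trigPoly {M : ℕ} (u : Fin M → ℝ) : Continuous (trigPoly u) := by
  unfold trigPoly
  fun_prop

theorem continuous_wsymbol_mul_trigPoly {α : ℝ} (hα : α ∈ Set.Ioo (1 : ℝ) 2) {M : ℕ}
    (u v : Fin M → ℝ) : Continuous fun θ =>
      (wsymbol α θ * (trigPoly u θ * (starRingEnd ℂ) (trigPoly v θ))).re :=
  Complex.continuous_re.comp ((continuous_wsymbol hα).mul ((continuous_trigPoly u).mul
    (Complex.continuous_conj.comp (continuous_trigPoly v))))

theorem integral_re_wsymbol_mul_trigPoly {α : ℝ} (hα : α ∈ Set.Ioo (1 : ℝ) 2) {M : ℕ}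
    (u v : Fin M → ℝ) :
    ∫ θ in (-Real.pi)..Real.pi,
        (wsymbol α θ * (trigPoly u θ * (starRingEnd ℂ) (trigPoly v θ))).re =
      -(2 * Real.pi * (v ⬝ᵥ (Gmat α M *ᵥ u))) := by
  have hw := continuous_wsymbol hα
  have hu := continuous_trigPoly u
  have hv := continuous_trigPoly v
  have hint : IntervalIntegrable
      (fun θ => wsymbol α θ * (trigPoly u θ * (starRingEnd ℂ) (trigPoly v θ)))
      MeasureTheory.volume (-Real.pi) Real.pi :=
    (hw.mul (hu.mul (Complex.continuous_conj.comp hv))).intervalIntegrable _ _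
  have hre := Complex.reCLM.intervalIntegral_comp_comm hint
  simp only [Complex.reCLM_apply] at hre
  rw [hre]
  have hexp : ∀ θ, wsymbol α θ * (trigPoly u θ * (starRingEnd ℂ) (trigPoly v θ)) =
      ∑ i, ∑ j, ((v i : ℂ) * u j) * (wsymbol α θ *
        Complex.exp (-((((i : ℤ) - (j : ℤ) : ℤ) : ℂ) * θ * Complex.I))) := by
    intro θ
    simp only [trigPoly, map_sum, map_mul, Complex.conj_ofReal, ← Complex.exp_conj, Complex.conj_I,
      Complex.conj_natCast]
    rw [mul_comm (∑ j, _), Finset.sum_mul_sum, Finset.mul_sum]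
    simp only [Finset.mul_sum]
    refine Finset.sum_congr rfl fun i _ => Finset.sum_congr rfl fun j _ => ?_
    rw [show -((((i : ℤ) - (j : ℤ) : ℤ) : ℂ) * θ * Complex.I) =
      (j : ℕ) * θ * Complex.I + (i : ℕ) * θ * -Complex.I by push_cast; ring, Complex.exp_add]
    ring
  simp only [hexp]
  rw [intervalIntegral.integral_finsetSum]
  swap
  · intro i _
    exact Continuous.intervalIntegrable (by fun_prop) _ _
  simp_rw [dotProduct, Matrix.mulVec, dotProduct, Gmat_apply, Complex.re_sum, Finset.mul_sum,
    ← Finset.sum_neg_distrib]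
  refine Finset.sum_congr rfl fun i _ => ?_
  rw [intervalIntegral.integral_finsetSum, Complex.re_sum]
  swap
  · intro j _
    exact Continuous.intervalIntegrable (by fun_prop) _ _
  refine Finset.sum_congr rfl fun j _ => ?_
  rw [intervalIntegral.integral_const_mul, integral_wsymbol_mul_exp hα]
  norm_cast
  ring

theorem cos_mul_dotProduct_Gmat_le {α : ℝ} (hα : α ∈ Set.Ioo (1 : ℝ) 2) {M : ℕ}
    (u v : Fin M → ℝ) {t : ℝ} (ht : 0 < t) :
    |Real.cos (α * Real.pi / 2)| * (v ⬝ᵥ (Gmat α M *ᵥ u)) ≤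
      (t * -(u ⬝ᵥ (Gmat α M *ᵥ u)) + t⁻¹ * -(v ⬝ᵥ (Gmat α M *ᵥ v))) / 2 := by
  set c := |Real.cos (α * Real.pi / 2)| with hc
  have hπ := Real.pi_pos
  have hnn : 0 ≤ ∫ θ in (-Real.pi)..Real.pi,
      ((t / 2 * (wsymbol α θ * (trigPoly u θ * (starRingEnd ℂ) (trigPoly u θ))).re +
      t⁻¹ / 2 * (wsymbol α θ * (trigPoly v θ * (starRingEnd ℂ) (trigPoly v θ))).re) +
      c * (wsymbol α θ * (trigPoly u θ * (starRingEnd ℂ) (trigPoly v θ))).re) := by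
    refine intervalIntegral.integral_nonneg (by linarith) fun θ hθ => ?_
    have hs := cos_mul_norm_wsymbol_le hα θ hθ
    rw [← hc] at hs
    have hU := norm_nonneg (trigPoly u θ)
    have hV := norm_nonneg (trigPoly v θ)
    have hcr : -(c * ‖wsymbol α θ‖ * (‖trigPoly u θ‖ * ‖trigPoly v θ‖)) ≤
        c * (wsymbol α θ * (trigPoly u θ * (starRingEnd ℂ) (trigPoly v θ))).re := by
      have := (abs_le.mp (Complex.abs_re_le_norm
        (wsymbol α θ * (trigPoly u θ * (starRingEnd ℂ) (trigPoly v θ))))).1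
      rw [norm_mul, norm_mul, RCLike.norm_conj] at this
      have := mul_le_mul_of_nonneg_left this (abs_nonneg (Real.cos (α * Real.pi / 2)))
      rw [← hc] at this
      linarith
    have hsq : ∀ z : ℂ, (wsymbol α θ * (z * (starRingEnd ℂ) z)).re =
        (wsymbol α θ).re * ‖z‖ ^ 2 := by
      intro z
      rw [Complex.mul_conj, Complex.re_mul_ofReal, Complex.normSq_eq_norm_sq]
    rw [hsq, hsq]
    have hb := mul_le_mul_of_nonneg_right hs (mul_nonneg hU hV)
    have hp : 0 ≤ (wsymbol α θ).re := le_trans (by positivity) hs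
    have hamgm : ‖trigPoly u θ‖ * ‖trigPoly v θ‖ ≤
        t / 2 * ‖trigPoly u θ‖ ^ 2 + t⁻¹ / 2 * ‖trigPoly v θ‖ ^ 2 := by
      have h := mul_nonneg (inv_nonneg.mpr ht.le)
        (sq_nonneg (t * ‖trigPoly u θ‖ - ‖trigPoly v θ‖))
      have e : t⁻¹ * (t * ‖trigPoly u θ‖ - ‖trigPoly v θ‖) ^ 2 = t * ‖trigPoly u θ‖ ^ 2 -
          2 * (‖trigPoly u θ‖ * ‖trigPoly v θ‖) + t⁻¹ * ‖trigPoly v θ‖ ^ 2 := by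
        field_simp
        ring
      linarith
    have := mul_le_mul_of_nonneg_left hamgm hp
    linarith
  have huu := (continuous_wsymbol_mul_trigPoly hα u u).intervalIntegrable
    (μ := MeasureTheory.volume) (-Real.pi) Real.pi
  have hvv := (continuous_wsymbol_mul_trigPoly hα v v).intervalIntegrable
    (μ := MeasureTheory.volume) (-Real.pi) Real.pi
  have huv := (continuous_wsymbol_mul_trigPoly hα u v).intervalIntegrable
    (μ := MeasureTheory.volume) (-Real.pi) Real.pi
  rw [intervalIntegral.integral_add ((huu.const_mul _).add (hvv.const_mul _)) (huv.const_mul _),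
    intervalIntegral.integral_add (huu.const_mul _) (hvv.const_mul _),
    intervalIntegral.integral_const_mul, intervalIntegral.integral_const_mul,
    intervalIntegral.integral_const_mul, integral_re_wsymbol_mul_trigPoly hα,
    integral_re_wsymbol_mul_trigPoly hα, integral_re_wsymbol_mul_trigPoly hα] at hnn
  refine le_of_mul_le_mul_left ?_ (mul_pos two_pos hπ)
  linarith

theorem quadratic_form_nonneg_of_row_sum_nonneg {ι : Type*} [Fintype ι] {A : ι → ι → ℝ}
    (hsymm : ∀ i j, A i j = A j i) (hoff : ∀ i j, i ≠ j → A i j ≤ 0)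
    (hrow : ∀ i, 0 ≤ ∑ j, A i j) (u : ι → ℝ) : 0 ≤ ∑ i, ∑ j, A i j * (u i * u j) := by
  have h1 : 0 ≤ ∑ i, ∑ j, A i j * u i ^ 2 :=
    Finset.sum_nonneg fun i _ => by
      rw [← Finset.sum_mul]
      exact mul_nonneg (hrow i) (sq_nonneg _)
  have h2 : ∑ i, ∑ j, A i j * u j ^ 2 = ∑ i, ∑ j, A i j * u i ^ 2 := by
    rw [Finset.sum_comm]
    simp only [hsymm]
  have h3 : ∑ i, ∑ j, A i j * (u i - u j) ^ 2 ≤ 0 :=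
    Finset.sum_nonpos fun i _ => Finset.sum_nonpos fun j _ => by
      rcases eq_or_ne i j with rfl | hij
      · simp
      · exact mul_nonpos_of_nonpos_of_nonneg (hoff i j hij) (sq_nonneg _)
  have h4 : 2 * ∑ i, ∑ j, A i j * (u i * u j) = ∑ i, ∑ j, A i j * u i ^ 2 +
      ∑ i, ∑ j, A i j * u j ^ 2 - ∑ i, ∑ j, A i j * (u i - u j) ^ 2 := by
    simp only [Finset.mul_sum, ← Finset.sum_add_distrib, ← Finset.sum_sub_distrib]
    refine Finset.sum_congr rfl fun i _ => Finset.sum_congr rfl fun j _ => ?_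
    ring
  linarith

/-- The Toeplitz symbol coefficients of `G_α + G_αᵀ`, indexed by the diagonal. -/
noncomputable def bint (α : ℝ) (n : ℤ) : ℝ := wint α n + wint α (-n)

theorem bint_neg (α : ℝ) (n : ℤ) : bint α (-n) = bint α n := by
  rw [bint, bint, neg_neg, add_comm]

theorem wint_natCast (α : ℝ) (m : ℕ) : wint α m = wcoef α (m + 1) := by
  rw [wint, if_pos (by omega)]
  congr 1

theorem bint_zero (α : ℝ) : bint α 0 = 2 * wcoef α 1 := by
  have := wint_natCast α 0
  simp only [Nat.cast_zero, zero_add] at this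
  rw [bint, neg_zero, this]
  ring

theorem bint_one (α : ℝ) : bint α 1 = wcoef α 2 + wcoef α 0 := by
  simp [bint, wint]

theorem bint_add_two (α : ℝ) (m : ℕ) : bint α (m + 2) = wcoef α (m + 3) := by
  have := wint_natCast α (m + 2)
  push_cast at this
  rw [bint, this, wint, if_neg (by omega), add_zero]

theorem bint_succ_nonneg {α : ℝ} (hα : α ∈ Set.Ioo (1 : ℝ) 2) (m : ℕ) : 0 ≤ bint α (m + 1) := by
  obtain ⟨h1, h2⟩ := hα
  cases m with
  | zero =>
    rw [Nat.cast_zero, zero_add, bint_one]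
    simp only [wcoef, gcoef]
    norm_num
    nlinarith [mul_pos (mul_pos (by linarith : 0 < α) (by linarith : 0 < α - 1))
      (by linarith : 0 < α + 2)]
  | succ m =>
    rw [Nat.cast_succ, add_assoc, one_add_one_eq_two, bint_add_two, wcoef]
    have := gcoef_nonneg ⟨h1, h2⟩ m
    have := gcoef_nonneg ⟨h1, h2⟩ (m + 1)
    have : 0 ≤ 2 - α := by linarith
    have : 0 ≤ α := by linarith
    positivity

theorem bint_nonneg {α : ℝ} (hα : α ∈ Set.Ioo (1 : ℝ) 2) {n : ℤ} (hn : n ≠ 0) :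
    0 ≤ bint α n := by
  obtain ⟨m, hm⟩ : ∃ m : ℕ, n = m + 1 ∨ n = -(m + 1) := ⟨n.natAbs - 1, by omega⟩
  rcases hm with rfl | rfl
  · exact bint_succ_nonneg hα m
  · rw [bint_neg]
    exact bint_succ_nonneg hα m

theorem sum_wcoef (α : ℝ) (n : ℕ) : ∑ k ∈ Finset.range (n + 1), wcoef α k =
    α / 2 * ∑ k ∈ Finset.range (n + 1), gcoef α k +
      (2 - α) / 2 * ∑ k ∈ Finset.range n, gcoef α k := by
  rw [Finset.sum_range_succ', Finset.sum_range_succ' (gcoef α) n]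
  simp only [wcoef, Finset.sum_add_distrib, ← Finset.mul_sum]
  ring

theorem sum_bint (α : ℝ) (n : ℕ) : wcoef α 1 + ∑ m ∈ Finset.range (n + 1), bint α (m + 1) =
    ∑ k ∈ Finset.range (n + 3), wcoef α k := by
  induction n with
  | zero =>
    simp [Finset.sum_range_succ, bint_one]
    ring
  | succ n ih =>
    rw [Finset.sum_range_succ, ← add_assoc, ih, Finset.sum_range_succ _ (n + 3), Nat.cast_succ,
      add_assoc, one_add_one_eq_two, bint_add_two]

theorem bint_zero_add_sum_nonpos {α : ℝ} (hα : α ∈ Set.Ioo (1 : ℝ) 2) {n : ℕ} (hn : 0 < n) :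
    bint α 0 + 2 * ∑ m ∈ Finset.range n, bint α (m + 1) ≤ 0 := by
  obtain ⟨n, rfl⟩ := Nat.exists_eq_add_one.mpr hn
  have h := sum_bint α n
  rw [sum_wcoef] at h
  have h1 := mul_nonneg (by linarith [hα.1] : 0 ≤ α / 2)
    (neg_nonneg.mpr (gcoef_sum_nonpos hα (n + 1)))
  have h2 := mul_nonneg (by linarith [hα.2] : 0 ≤ (2 - α) / 2)
    (neg_nonneg.mpr (gcoef_sum_nonpos hα n))
  rw [bint_zero]
  linarith

theorem sum_Icc_neg_eq (F : ℤ → ℝ) (N : ℕ) : ∑ n ∈ Finset.Icc (-N : ℤ) N, F n =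
    F 0 + ∑ m ∈ Finset.range N, (F (m + 1) + F (-(m + 1))) := by
  induction N with
  | zero => simp
  | succ N ih =>
    rw [Finset.sum_range_succ, Nat.cast_succ, Finset.sum_Icc_succ_eq_add_endpoints, ih]
    ring

theorem row_sum_nonneg {α : ℝ} (hα : α ∈ Set.Ioo (1 : ℝ) 2) {M : ℕ} {c : ℤ → ℝ} {K : ℝ}
    (hc0 : ∀ n : ℤ, 0 ≤ n → n < M → 0 ≤ c n) (hcK : ∀ n : ℤ, 0 ≤ n → n < M → c n ≤ K)
    (hconv : ∀ n m : ℤ, 0 ≤ m → 0 ≤ n - m → n + m < M → 2 * c n ≤ c (n + m) + c (n - m))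
    (i : Fin M) :
    0 ≤ ∑ j : Fin M, bint α ((i : ℤ) - j) * (c i * c j - 2 * K ^ 2) := by
  have hi0 : (0 : ℤ) ≤ (i : ℤ) := by omega
  have hiM : (i : ℤ) < M := by omega
  set f : ℤ → ℝ := fun n =>
    if 0 ≤ (i : ℤ) + n ∧ (i : ℤ) + n < M then c i * c (i + n) - 2 * K ^ 2 else 0 with hf
  have hsum : ∑ j : Fin M, bint α ((i : ℤ) - j) * (c i * c j - 2 * K ^ 2) =
      ∑ n ∈ Finset.Icc (-M : ℤ) M, bint α n * f n := by
    refine Finset.sum_of_injOn (fun j : Fin M => (j : ℤ) - i) ?_ ?_ ?_ ?_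
    · intro a _ b _ hab
      have : (a : ℤ) - i = (b : ℤ) - i := hab
      omega
    · intro a _
      simp only [Finset.coe_Icc, Set.mem_Icc]
      omega
    · intro n _ hn
      rw [hf]
      dsimp only
      rw [if_neg, mul_zero]
      rintro ⟨h0, h1⟩
      refine hn ⟨⟨((i : ℤ) + n).toNat, by omega⟩, by simp, ?_⟩
      simp only
      omega
    · intro j _
      rw [hf]
      dsimp only
      rw [if_pos (by omega), ← bint_neg α ((j : ℤ) - i), neg_sub, add_sub_cancel]
  rw [hsum, sum_Icc_neg_eq]
  have hci0 := hc0 i hi0 hiM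
  have hciK := hcK i hi0 hiM
  have hf0 : f 0 = c i * c i - 2 * K ^ 2 := by
    rw [hf]
    dsimp only
    rw [add_zero, if_pos ⟨hi0, hiM⟩]
  have hK : 0 ≤ K := hci0.trans hciK
  have hcc : c i * c i ≤ K ^ 2 := by nlinarith
  have hsecond : ∀ m : ℕ, 2 * f 0 ≤ f (m + 1) + f (-(m + 1)) := by
    intro m
    rw [hf0]
    by_cases h1 : (i : ℤ) + (m + 1) < M <;> by_cases h2 : 0 ≤ (i : ℤ) + -(m + 1)
    · rw [hf]
      dsimp only
      rw [if_pos (by omega), if_pos (by omega)]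
      have h := mul_le_mul_of_nonneg_left (hconv i (m + 1) (by omega) (by omega) h1) hci0
      rw [← sub_eq_add_neg (i : ℤ)]
      linarith
    · rw [hf]
      dsimp only
      rw [if_pos (by omega), if_neg (by omega)]
      have := mul_nonneg hci0 (hc0 (i + (m + 1)) (by omega) h1)
      linarith
    · rw [hf]
      dsimp only
      rw [if_neg (by omega), if_pos (by omega)]
      have := mul_nonneg hci0 (hc0 (i + -(m + 1)) h2 (by omega))
      linarith
    · rw [hf]
      dsimp only
      rw [if_neg (by omega), if_neg (by omega)]
      nlinarith
  have hS : ∑ m ∈ Finset.range M, bint α (m + 1) * (2 * f 0) ≤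
      ∑ m ∈ Finset.range M, (bint α (m + 1) * f (m + 1) + bint α (-(m + 1)) * f (-(m + 1))) :=
    Finset.sum_le_sum fun m _ => by
      rw [bint_neg, ← mul_add]
      exact mul_le_mul_of_nonneg_left (hsecond m) (bint_succ_nonneg hα m)
  rw [← Finset.sum_mul] at hS
  have h0 := bint_zero_add_sum_nonpos hα (n := M) (by omega)
  have hf0' : f 0 ≤ 0 := by rw [hf0]; nlinarith
  have := mul_nonneg_of_nonpos_of_nonpos h0 hf0'
  linarith

theorem two_mul_dotProduct_Gmat (α : ℝ) {M : ℕ} (v : Fin M → ℝ) :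
    2 * (v ⬝ᵥ (Gmat α M *ᵥ v)) =
      ∑ i : Fin M, ∑ j : Fin M, bint α ((i : ℤ) - j) * (v i * v j) := by
  have h : v ⬝ᵥ (Gmat α M *ᵥ v) =
      ∑ i : Fin M, ∑ j : Fin M, wint α ((i : ℤ) - j) * (v i * v j) := by
    simp only [dotProduct, Matrix.mulVec, Gmat_apply, Finset.mul_sum]
    refine Finset.sum_congr rfl fun i _ => Finset.sum_congr rfl fun j _ => by ring
  rw [two_mul]
  nth_rewrite 2 [h]
  rw [Finset.sum_comm, h]
  simp only [← Finset.sum_add_distrib]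
  refine Finset.sum_congr rfl fun i _ => Finset.sum_congr rfl fun j _ => ?_
  rw [bint, neg_sub]
  ring

theorem neg_dotProduct_Gmat_mul_le {α : ℝ} (hα : α ∈ Set.Ioo (1 : ℝ) 2) {M : ℕ} {c : ℤ → ℝ}
    {K : ℝ} (hc0 : ∀ n : ℤ, 0 ≤ n → n < M → 0 ≤ c n) (hcK : ∀ n : ℤ, 0 ≤ n → n < M → c n ≤ K)
    (hconv : ∀ n m : ℤ, 0 ≤ m → 0 ≤ n - m → n + m < M → 2 * c n ≤ c (n + m) + c (n - m))
    (u : Fin M → ℝ) :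
    -((fun i : Fin M => c i * u i) ⬝ᵥ (Gmat α M *ᵥ fun i : Fin M => c i * u i)) ≤
      2 * K ^ 2 * -(u ⬝ᵥ (Gmat α M *ᵥ u)) := by
  have h := quadratic_form_nonneg_of_row_sum_nonneg
    (A := fun i j : Fin M => bint α ((i : ℤ) - j) * (c i * c j - 2 * K ^ 2))
    (fun i j => by rw [← bint_neg, neg_sub, mul_comm (c i)])
    (fun i j hij => by
      refine mul_nonpos_of_nonneg_of_nonpos (bint_nonneg hα (by omega)) ?_
      have h1 := mul_le_mul (hcK i (by omega) (by omega)) (hcK j (by omega) (by omega))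
        (hc0 j (by omega) (by omega)) ((hc0 i (by omega) (by omega)).trans
          (hcK i (by omega) (by omega)))
      nlinarith [sq_nonneg K])
    (row_sum_nonneg hα hc0 hcK hconv) u
  have h1 := two_mul_dotProduct_Gmat α fun i : Fin M => c i * u i
  have h2 := two_mul_dotProduct_Gmat α u
  have h3 : ∑ i : Fin M, ∑ j : Fin M, bint α ((i : ℤ) - j) * (c i * c j - 2 * K ^ 2) *
      (u i * u j) = ∑ i : Fin M, ∑ j : Fin M, bint α ((i : ℤ) - j) * (c i * u i * (c j * u j)) -
      2 * K ^ 2 * ∑ i : Fin M, ∑ j : Fin M, bint α ((i : ℤ) - j) * (u i * u j) := by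
    simp only [Finset.mul_sum, ← Finset.sum_sub_distrib]
    refine Finset.sum_congr rfl fun i _ => Finset.sum_congr rfl fun j _ => by ring
  rw [h3, ← h1, ← h2] at h
  linarith

theorem abs_dotProduct_Gmat_le {α : ℝ} (hα : α ∈ Set.Ioo (1 : ℝ) 2) {M : ℕ} {c : ℤ → ℝ} {K : ℝ}
    (hK : 0 ≤ K)
    (hc0 : ∀ n : ℤ, 0 ≤ n → n < M → 0 ≤ c n) (hcK : ∀ n : ℤ, 0 ≤ n → n < M → c n ≤ K)
    (hconv : ∀ n m : ℤ, 0 ≤ m → 0 ≤ n - m → n + m < M → 2 * c n ≤ c (n + m) + c (n - m))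
    (u : Fin M → ℝ) :
    |(fun i : Fin M => c i * u i) ⬝ᵥ (Gmat α M *ᵥ u)| ≤
      Real.sqrt 2 * K / |Real.cos (α * Real.pi / 2)| * -(u ⬝ᵥ (Gmat α M *ᵥ u)) := by
  have hcos : 0 < |Real.cos (α * Real.pi / 2)| := by
    have hπ := Real.pi_pos
    refine abs_pos.mpr (Real.cos_neg_of_pi_div_two_lt_of_lt ?_ ?_).ne <;> nlinarith [hα.1, hα.2]
  rcases hK.eq_or_lt with rfl | hK
  · have : (fun i : Fin M => c i * u i) = 0 := by
      ext i
      rw [le_antisymm (hcK i (by omega) (by omega)) (hc0 i (by omega) (by omega))]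
      simp
    simp [this]
  set v := fun i : Fin M => c i * u i with hv
  have hv2 := neg_dotProduct_Gmat_mul_le hα hc0 hcK hconv u
  rw [← hv] at hv2
  have ht : 0 < Real.sqrt 2 * K := by positivity
  have ht2 : (Real.sqrt 2 * K)⁻¹ * (2 * K ^ 2) = Real.sqrt 2 * K := by
    rw [inv_mul_eq_iff_eq_mul₀ ht.ne', mul_mul_mul_comm, Real.mul_self_sqrt two_pos.le]
    ring
  have hbd := mul_le_mul_of_nonneg_left hv2 (inv_nonneg.mpr ht.le)
  rw [← mul_assoc, ht2] at hbd
  have h1 := cos_mul_dotProduct_Gmat_le hα u v ht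
  have h2 := cos_mul_dotProduct_Gmat_le hα u (-v) ht
  simp only [neg_dotProduct, Matrix.mulVec_neg, dotProduct_neg, neg_neg, mul_neg] at h1 h2 hbd
  rw [div_mul_eq_mul_div, le_div_iff₀' hcos, ← abs_of_pos hcos, ← abs_mul, abs_le]
  constructor <;> linarith

/-- If `0 ≤ κ_min ≤ d ≤ κ_max` on `(x_L,x_R)`, `d` is concave (with `κ = κ_max`) or
convex (with `κ = κ_min`), and `D̃ = diag(d(x_i)) − κ I`, then
`|uᵀ(−D̃ G_α − G_αᵀ D̃)u| ≤ (√2 (κ_max − κ_min)/ς_α) uᵀ G u` with `G = −G_α − G_αᵀ`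
and `ς_α = |cos(απ/2)|`. -/
theorem tilde_diag_bilinear_bound (α : ℝ) (hα : α ∈ Set.Ioo (1 : ℝ) 2)
    (xL xR : ℝ) (hx : xL < xR) (M : ℕ) (hM : 0 < M) (d : ℝ → ℝ)
    (κmin κmax κ : ℝ) (hκmin : 0 ≤ κmin)
    (hbound : ∀ x ∈ Set.Ioo xL xR, κmin ≤ d x ∧ d x ≤ κmax)
    (hκ : (ConcaveOn ℝ (Set.Ioo xL xR) d ∧ κ = κmax) ∨
          (ConvexOn ℝ (Set.Ioo xL xR) d ∧ κ = κmin))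
    (u : Fin M → ℝ) :
    let h := (xR - xL) / (M + 1)
    let X : Fin M → ℝ := fun i => xL + ((i : ℕ) + 1) * h
    let D : Matrix (Fin M) (Fin M) ℝ := Matrix.diagonal fun i => d (X i)
    let Dt : Matrix (Fin M) (Fin M) ℝ := D - κ • (1 : Matrix (Fin M) (Fin M) ℝ)
    let G : Matrix (Fin M) (Fin M) ℝ := -(Gmat α M) - (Gmat α M)ᵀ
    |u ⬝ᵥ ((-(Dt * Gmat α M) - (Gmat α M)ᵀ * Dt) *ᵥ u)| ≤
      Real.sqrt 2 * (κmax - κmin) / |Real.cos (α * Real.pi / 2)| * (u ⬝ᵥ (G *ᵥ u)) := by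
  intro h X D Dt G
  have hMpos : (0 : ℝ) < M + 1 := by positivity
  have hh : 0 < h := div_pos (sub_pos.mpr hx) hMpos
  have hhM : (M + 1) * h = xR - xL := mul_div_cancel₀ _ hMpos.ne'
  set Y : ℤ → ℝ := fun n => xL + (n + 1) * h with hY
  have hYmem : ∀ n : ℤ, 0 ≤ n → n < M → Y n ∈ Set.Ioo xL xR := by
    intro n h0 h1
    have h0' : (0 : ℝ) ≤ n := by exact_mod_cast h0
    have h1' : (n : ℝ) < M := by exact_mod_cast h1
    constructor
    · have : 0 < ((n : ℝ) + 1) * h := by positivity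
      simp only [hY]
      linarith
    · have := mul_lt_mul_of_pos_right (add_lt_add_left h1' 1) hh
      simp only [hY]
      linarith
  have hmid : ∀ n m : ℤ, (1 / 2 : ℝ) • Y (n + m) + (1 / 2 : ℝ) • Y (n - m) = Y n := by
    intro n m
    simp only [hY, smul_eq_mul]
    push_cast
    ring
  have hform : u ⬝ᵥ ((-(Dt * Gmat α M) - (Gmat α M)ᵀ * Dt) *ᵥ u) =
      -2 * ((fun i : Fin M => (d (Y i) - κ) * u i) ⬝ᵥ (Gmat α M *ᵥ u)) := by
    have hDt : Dt = Matrix.diagonal fun i : Fin M => d (Y i) - κ := by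
      simp only [Dt, D, X, hY, Matrix.smul_one_eq_diagonal, Matrix.diagonal_sub, Int.cast_natCast]
    have hdiag : (Matrix.diagonal fun i : Fin M => d (Y i) - κ) *ᵥ u =
        fun i : Fin M => (d (Y i) - κ) * u i := by
      ext i
      rw [Matrix.mulVec_diagonal]
    have e1 : u ⬝ᵥ ((Dt * Gmat α M) *ᵥ u) =
        (fun i : Fin M => (d (Y i) - κ) * u i) ⬝ᵥ (Gmat α M *ᵥ u) := by
      rw [← Matrix.mulVec_mulVec, Matrix.dotProduct_mulVec, ← Matrix.mulVec_transpose, hDt,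
        Matrix.diagonal_transpose, hdiag]
    have e2 : u ⬝ᵥ (((Gmat α M)ᵀ * Dt) *ᵥ u) =
        (fun i : Fin M => (d (Y i) - κ) * u i) ⬝ᵥ (Gmat α M *ᵥ u) := by
      rw [← Matrix.mulVec_mulVec, Matrix.dotProduct_mulVec, Matrix.vecMul_transpose, hDt, hdiag,
        dotProduct_comm]
    rw [Matrix.sub_mulVec, Matrix.neg_mulVec, dotProduct_sub, dotProduct_neg, e1, e2]
    ring
  have hG : u ⬝ᵥ (G *ᵥ u) = 2 * -(u ⬝ᵥ (Gmat α M *ᵥ u)) := by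
    have : u ⬝ᵥ ((Gmat α M)ᵀ *ᵥ u) = u ⬝ᵥ (Gmat α M *ᵥ u) := by
      rw [Matrix.dotProduct_mulVec, Matrix.vecMul_transpose, dotProduct_comm]
    simp only [G]
    rw [Matrix.sub_mulVec, Matrix.neg_mulVec, dotProduct_sub, dotProduct_neg, this]
    ring
  have hK : 0 ≤ κmax - κmin := by
    have := hbound _ (hYmem 0 le_rfl (by exact_mod_cast hM))
    linarith
  have hmain : |(fun i : Fin M => (d (Y i) - κ) * u i) ⬝ᵥ (Gmat α M *ᵥ u)| ≤
      Real.sqrt 2 * (κmax - κmin) / |Real.cos (α * Real.pi / 2)| *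
        -(u ⬝ᵥ (Gmat α M *ᵥ u)) := by
    rcases hκ with ⟨hd, rfl⟩ | ⟨hd, rfl⟩
    · have hneg : (fun i : Fin M => (d (Y i) - κ) * u i) =
          -fun i : Fin M => (κ - d (Y i)) * u i := by
        ext i
        simp only [Pi.neg_apply]
        ring
      rw [hneg, neg_dotProduct, abs_neg]
      refine abs_dotProduct_Gmat_le hα (c := fun n => κ - d (Y n)) hK ?_ ?_ ?_ u
      · intro n h0 h1
        linarith [(hbound _ (hYmem n h0 h1)).2]
      · intro n h0 h1
        linarith [(hbound _ (hYmem n h0 h1)).1]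
      · intro n m hm h0 h1
        have := hd.2 (hYmem (n + m) (by omega) h1) (hYmem (n - m) h0 (by omega))
          (by norm_num : (0 : ℝ) ≤ 1 / 2) (by norm_num : (0 : ℝ) ≤ 1 / 2) (by norm_num)
        rw [hmid, smul_eq_mul, smul_eq_mul] at this
        linarith
    · refine abs_dotProduct_Gmat_le hα (c := fun n => d (Y n) - κ) hK ?_ ?_ ?_ u
      · intro n h0 h1
        linarith [(hbound _ (hYmem n h0 h1)).1]
      · intro n h0 h1
        linarith [(hbound _ (hYmem n h0 h1)).2]
      · intro n m hm h0 h1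
        have := hd.2 (hYmem (n + m) (by omega) h1) (hYmem (n - m) h0 (by omega))
          (by norm_num : (0 : ℝ) ≤ 1 / 2) (by norm_num : (0 : ℝ) ≤ 1 / 2) (by norm_num)
        rw [hmid, smul_eq_mul, smul_eq_mul] at this
        linarith
  rw [hform, hG, abs_mul, abs_neg, abs_two]
  linarith
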